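/- Let X be a germ at 0 ∈ ℂ² of a holomorphic vector field with X(0) = 0 whose linear part DX(0) has eigenvalues λ₁, λ₂ with λ₁ ≠ 0 and λ₂/λ₁ ∉ ℝ_{≤0} (in particular λ₂ ≠ 0). Then, up to permuting λ₁ and λ₂, one of the following holds: either there exists a germ of biholomorphism Φ : (ℂ²,0) → (ℂ²,0) with DΦ(p)·X(p) = X_lin(Φ(p)) near 0, where X_lin = λ₁·x∂x + λ₂·y∂y; or there exists an integer k ≥ 1 with λ₂ = k·λ₁ and a germ of biholomorphism Φ : (ℂ²,0) → (ℂ²,0) with DΦ(p)·X(p) = X_k(Φ(p)) near 0, where X_k = λ₁·(k·x + y^k)∂x + λ₁·y∂y. -/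

import Mathlib

open Filter

open scoped Topology

namespace PoincareDulac

/-- Absolutely summable complex families indexed by `ι`. -/
noncomputable abbrev Ell1 (ι : Type) := lp (fun _ : ι => ℂ) 1

/-- Exponents of the monomials of degree at least two. -/
abbrev Idx := {m : ℕ × ℕ // 2 ≤ m.1 + m.2}

/-- The monomial with exponent `m`. -/
def mono (m : ℕ × ℕ) (p : ℂ × ℂ) : ℂ := p.1 ^ m.1 * p.2 ^ m.2

/-- The sum of the power series with coefficients `a`. -/
noncomputable def ev (a : Ell1 Idx) (p : ℂ × ℂ) : ℂ := ∑' m : Idx, a m * mono m p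

lemma hasSum_norm_ell1 {ι : Type} (a : Ell1 ι) : HasSum (fun i => ‖a i‖) ‖a‖ := by
  have := lp.hasSum_norm (p := 1) (by simp) a
  simpa using this

lemma norm_ell1_apply_le {ι : Type} (a : Ell1 ι) (i : ι) : ‖a i‖ ≤ ‖a‖ :=
  lp.norm_apply_le_norm one_ne_zero a i

lemma exists_ell1_lift {ι : Type} {F : Type*} [NormedAddCommGroup F] [NormedSpace ℂ F]
    [CompleteSpace F] (t : ι → F) (C : ℝ) (hC : 0 ≤ C) (ht : ∀ i, ‖t i‖ ≤ C) :
    ∃ T : Ell1 ι →L[ℂ] F, ‖T‖ ≤ C ∧ ∀ b, HasSum (fun i => b i • t i) (T b) := by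
  have hb : ∀ (b : Ell1 ι) i, ‖b i • t i‖ ≤ C * ‖b i‖ := fun b i => by
    rw [norm_smul, mul_comm]; gcongr; exact ht i
  have hs : ∀ b : Ell1 ι, Summable (fun i => b i • t i) := fun b =>
    Summable.of_norm_bounded ((hasSum_norm_ell1 b).mul_left C).summable (hb b)
  let T₀ : Ell1 ι →ₗ[ℂ] F :=
    { toFun := fun b => ∑' i, b i • t i
      map_add' := fun b c => by
        rw [← (hs b).tsum_add (hs c)]
        congr 1; ext i; simp [add_smul]
      map_smul' := fun r b => by
        rw [RingHom.id_apply, ← (hs b).tsum_const_smul r]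
        congr 1; ext i; simp [mul_smul] }
  have hT : ∀ b, ‖T₀ b‖ ≤ C * ‖b‖ := fun b =>
    tsum_of_norm_bounded ((hasSum_norm_ell1 b).mul_left C) (hb b)
  exact ⟨T₀.mkContinuous C hT, T₀.mkContinuous_norm_le hC hT, fun b => (hs b).hasSum⟩

lemma norm_mono_le {p : ℂ × ℂ} (hp : ‖p‖ ≤ 1) (m : ℕ × ℕ) : ‖mono m p‖ ≤ 1 := by
  have h1 := (norm_fst_le p).trans hp
  have h2 := (norm_snd_le p).trans hp
  rw [mono, norm_mul, norm_pow, norm_pow]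
  exact mul_le_one₀ (pow_le_one₀ (norm_nonneg _) h1) (by positivity)
    (pow_le_one₀ (norm_nonneg _) h2)

lemma exists_evaluation {p : ℂ × ℂ} (hp : ‖p‖ ≤ 1) :
    ∃ E : Ell1 Idx →L[ℂ] ℂ, ∀ a, E a = ev a p := by
  obtain ⟨T, -, hT⟩ := exists_ell1_lift (fun m : Idx => mono m p) 1 zero_le_one
    (fun m => norm_mono_le hp m)
  exact ⟨T, fun a => (hT a).tsum_eq.symm⟩

lemma ev_single (m : Idx) (p : ℂ × ℂ) : ev (lp.single 1 m 1) p = mono m p := by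
  rw [ev, tsum_eq_single m]
  · simp
  · intro n hn
    simp [Pi.single_eq_of_ne hn]

lemma norm_single_one {ι : Type} [DecidableEq ι] (m : ι) : ‖(lp.single 1 m 1 : Ell1 ι)‖ = 1 := by
  rw [lp.norm_single zero_lt_one]; simp

/-- Multiplication by the monomial with exponents `(i, j)`, on the level of exponents. -/
def shiftIdx (i j : ℕ) (m : Idx) : Idx := ⟨(i + m.1.1, j + m.1.2), by have := m.2; simp; omega⟩

lemma exists_shift (a : Ell1 Idx) (i j : ℕ) :
    ∃ b : Ell1 Idx, ‖b‖ ≤ ‖a‖ ∧ ∀ p : ℂ × ℂ, ‖p‖ ≤ 1 → ev b p = mono (i, j) p * ev a p := by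
  obtain ⟨S, hS, hS'⟩ := exists_ell1_lift
    (fun m : Idx => (lp.single 1 (shiftIdx i j m) 1 : Ell1 Idx)) 1 zero_le_one
    (fun m => (norm_single_one _).le)
  refine ⟨S a, (S.le_of_opNorm_le hS a).trans_eq (one_mul _), fun p hp => ?_⟩
  obtain ⟨E, hE⟩ := exists_evaluation hp
  have := (hS' a).mapL E
  rw [← hE, ← this.tsum_eq, ev, ← tsum_mul_left]
  refine tsum_congr fun m => ?_
  rw [map_smul, hE, ev_single]
  simp [mono, shiftIdx]
  ring

lemma differentiableOn_powers : ∀ ρ : ℝ, 0 ≤ ρ → ρ < 1 →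
    DifferentiableOn ℂ (fun x : ℂ => ∑' i : ℕ, x ^ i • (lp.single 1 i 1 : Ell1 ℕ))
      (Metric.ball 0 ρ) := by
  intro ρ h0 h1
  refine Complex.differentiableOn_tsum_of_summable_norm (u := fun i => ρ ^ i)
    (summable_geometric_of_lt_one h0 h1) (fun i => ?_) Metric.isOpen_ball (fun i w hw => ?_)
  · fun_prop
  · rw [norm_smul, norm_single_one, mul_one, norm_pow]
    have : ‖w‖ < ρ := by simpa using hw
    gcongr

lemma powers_apply {x : ℂ} (hx : ‖x‖ < 1) (n : ℕ) :
    (∑' i : ℕ, x ^ i • (lp.single 1 i 1 : Ell1 ℕ)) n = x ^ n := by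
  have hs : Summable (fun i : ℕ => x ^ i • (lp.single 1 i 1 : Ell1 ℕ)) := by
    refine Summable.of_norm_bounded (summable_geometric_of_lt_one (norm_nonneg x) hx) fun i => ?_
    rw [norm_smul, norm_single_one, mul_one, norm_pow]
  have h := hs.hasSum.mapL (lp.evalCLM ℂ (fun _ : ℕ => ℂ) 1 n)
  have h2 : lp.evalCLM ℂ (fun _ : ℕ => ℂ) 1 n (∑' i : ℕ, x ^ i • (lp.single 1 i 1 : Ell1 ℕ))
    = (∑' i : ℕ, x ^ i • (lp.single 1 i 1 : Ell1 ℕ)) n := rfl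
  rw [← h2, ← h.tsum_eq, tsum_eq_single n]
  · rw [map_smul]
    change x ^ n • (lp.single 1 n 1 : Ell1 ℕ) n = _
    simp
  · intro i hi
    rw [map_smul]
    change x ^ i • (lp.single 1 i 1 : Ell1 ℕ) n = _
    simp [Pi.single_eq_of_ne hi.symm]

lemma analyticAt_ev (a : Ell1 Idx) : AnalyticAt ℂ (ev a) 0 := by
  let c : ℕ → Ell1 ℕ →L[ℂ] ℂ := fun n => lp.evalCLM ℂ (fun _ : ℕ => ℂ) 1 n
  have hc : ∀ n, ‖c n‖ ≤ 1 := fun n =>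
    ContinuousLinearMap.opNorm_le_bound _ zero_le_one fun b => by
      rw [one_mul]; exact norm_ell1_apply_le b n
  let P : ℂ → Ell1 ℕ := fun x => ∑' i : ℕ, x ^ i • lp.single 1 i 1
  obtain ⟨T, -, hT⟩ := exists_ell1_lift
    (fun m : Idx => (c m.1.1).smulRight (c m.1.2)) 1 zero_le_one (fun m => by
      rw [ContinuousLinearMap.norm_smulRight_apply]
      exact mul_le_one₀ (hc _) (norm_nonneg _) (hc _))
  have hP : AnalyticAt ℂ P 0 := (differentiableOn_powers (1 / 2) (by norm_num) (by norm_num)).analyticAt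
    (Metric.ball_mem_nhds _ (by norm_num))
  have h1 : AnalyticAt ℂ (fun p : ℂ × ℂ => P p.1) 0 :=
    AnalyticAt.comp (g := P) (f := Prod.fst) hP analyticAt_fst
  have h2 : AnalyticAt ℂ (fun p : ℂ × ℂ => P p.2) 0 :=
    AnalyticAt.comp (g := P) (f := Prod.snd) hP analyticAt_snd
  have h3 : AnalyticAt ℂ (fun p : ℂ × ℂ => T a (P p.1) (P p.2)) 0 := 
    AnalyticAt.comp (g := fun q : Ell1 ℕ × Ell1 ℕ => T a q.1 q.2)
      ((T a).analyticAt_bilinear _) (h1.prod h2)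
  refine h3.congr ?_
  filter_upwards [Metric.ball_mem_nhds (0 : ℂ × ℂ) one_pos] with p hp
  have hp : ‖p‖ < 1 := by simpa using hp
  have hs := ((hT a).mapL (ContinuousLinearMap.apply ℂ _ (P p.1))).mapL
    (ContinuousLinearMap.apply ℂ _ (P p.2))
  simp only [ContinuousLinearMap.apply_apply] at hs
  rw [← hs.tsum_eq, ev]
  refine tsum_congr fun m => ?_
  have e1 : c m.1.1 (P p.1) = p.1 ^ m.1.1 := powers_apply ((norm_fst_le p).trans_lt hp) _
  have e2 : c m.1.2 (P p.2) = p.2 ^ m.1.2 := powers_apply ((norm_snd_le p).trans_lt hp) _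
  simp [mono, e1, e2]

lemma exists_coeffs_homogeneous {n : ℕ} (hn : 2 ≤ n) (P : (ℂ × ℂ) [×n]→L[ℂ] ℂ) :
    ∃ A : Ell1 Idx, ‖A‖ ≤ 2 ^ n * ‖P‖ ∧ ∀ q : ℂ × ℂ, ‖q‖ ≤ 1 → ev A q = P (fun _ => q) := by
  have hcard : ∀ s : Finset (Fin n), s.card ≤ n := fun s => by simpa using s.card_le_univ
  let e : Finset (Fin n) → Fin n → ℂ × ℂ := fun s => s.piecewise (fun _ => (1, 0)) (fun _ => (0, 1))
  have he : ∀ s i, ‖e s i‖ ≤ 1 := fun s i => by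
    by_cases h : i ∈ s <;> simp [e, h, Prod.norm_def]
  let idx : Finset (Fin n) → Idx := fun s => ⟨(s.card, n - s.card), by
    have := hcard s; simp only; omega⟩
  refine ⟨∑ s, P (e s) • lp.single 1 (idx s) 1, ?_, fun q hq => ?_⟩
  · calc ‖∑ s, P (e s) • (lp.single 1 (idx s) 1 : Ell1 Idx)‖
        ≤ ∑ s : Finset (Fin n), ‖P‖ := by
          refine norm_sum_le_of_le _ fun s _ => ?_
          rw [norm_smul, norm_single_one, mul_one]
          refine (P.le_opNorm _).trans ?_
          refine mul_le_of_le_one_right (norm_nonneg _) ?_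
          exact Finset.prod_le_one (fun _ _ => norm_nonneg _) (fun i _ => he s i)
      _ = 2 ^ n * ‖P‖ := by simp
  · obtain ⟨E, hE⟩ := exists_evaluation hq
    rw [← hE, map_sum]
    have h1 : (fun _ : Fin n => q) = (fun _ => q.1 • ((1, 0) : ℂ × ℂ)) +
        (fun _ => q.2 • ((0, 1) : ℂ × ℂ)) := by
      ext i <;> simp
    have h2 := P.toMultilinearMap.map_add_univ (fun _ : Fin n => q.1 • ((1, 0) : ℂ × ℂ))
      (fun _ => q.2 • ((0, 1) : ℂ × ℂ))
    rw [← h1] at h2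
    refine Eq.trans ?_ h2.symm
    refine Finset.sum_congr rfl fun s _ => ?_
    have h3 : (s.piecewise (fun _ : Fin n => q.1 • ((1, 0) : ℂ × ℂ)) (fun _ => q.2 • (0, 1)))
      = fun i => s.piecewise (fun _ => q.1) (fun _ => q.2) i • e s i := by
      funext i
      by_cases h : i ∈ s <;> simp [e, h]
    rw [h3, MultilinearMap.map_smul_univ, Finset.prod_piecewise, map_smul, hE, ev_single]
    simp only [Finset.univ_inter, Finset.prod_const, mono, idx, smul_eq_mul,
      ContinuousMultilinearMap.coe_coe]
    rw [Finset.card_sdiff_of_subset (Finset.subset_univ s)]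
    simp
    ring

lemma apply_eq_zero_of_isBigO {f : ℂ × ℂ → ℂ} {P : FormalMultilinearSeries ℂ (ℂ × ℂ) ℂ}
    (hP : HasFPowerSeriesAt f P 0) {N : ℕ} (hO : f =O[𝓝 0] fun p => ‖p‖ ^ (N + 1)) :
    ∀ n ≤ N, ∀ y, P n (fun _ => y) = 0 := by
  intro n
  induction n using Nat.strong_induction_on with
  | _ n ih =>
    intro hn
    refine Asymptotics.IsBigO.continuousMultilinearMap_apply_eq_zero ?_
    have h1 := hP.isBigO_sub_partialSum_pow (n + 1)
    have h2 : f =O[𝓝 0] fun p => ‖p‖ ^ (n + 1) := by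
      refine hO.trans (Asymptotics.IsBigO.of_bound 1 ?_)
      filter_upwards [Metric.ball_mem_nhds (0 : ℂ × ℂ) one_pos] with p hp
      have hp : ‖p‖ < 1 := by simpa using hp
      simp only [norm_pow, norm_norm, one_mul]
      exact pow_le_pow_of_le_one (norm_nonneg _) hp.le (by omega)
    simp only [zero_add] at h1
    refine (h2.sub h1).congr_left fun y => ?_
    rw [sub_sub_cancel, FormalMultilinearSeries.partialSum, Finset.sum_range_succ,
      Finset.sum_eq_zero, zero_add]
    intro i hi
    exact ih i (Finset.mem_range.mp hi) (by have := Finset.mem_range.mp hi; omega) y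

lemma exists_coeffs {f : ℂ × ℂ → ℂ} (hf : AnalyticAt ℂ f 0) {N : ℕ} (hN : 1 ≤ N)
    (hO : f =O[𝓝 0] fun p => ‖p‖ ^ (N + 1)) :
    ∃ C : ℝ, 0 ≤ C ∧ ∀ᶠ r in 𝓝[>] (0 : ℝ), ∃ a : Ell1 Idx, ‖a‖ ≤ C * r ∧
      ∀ p : ℂ × ℂ, ‖p‖ ≤ 1 → f ((r : ℂ) • p) = (r : ℂ) ^ N * ev a p := by
  obtain ⟨P, hP⟩ := hf
  have hzero := apply_eq_zero_of_isBigO hP hO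
  obtain ⟨R, hR⟩ := hP
  obtain ⟨ρ, hρ0, hρR⟩ := ENNReal.lt_iff_exists_nnreal_btwn.mp hR.r_pos
  have hρ : 0 < ρ := by exact_mod_cast hρ0
  obtain ⟨C₀, hC₀, hbound⟩ := P.norm_mul_pow_le_of_lt_radius (hρR.trans_le hR.r_le)
  choose A hA hAev using fun j : ℕ => exists_coeffs_homogeneous
    (show 2 ≤ j + (N + 1) by omega) (P (j + (N + 1)))
  have hρ' : (0 : ℝ) < ρ := hρ
  refine ⟨C₀ * (2 / ρ) ^ (N + 1) * 2, by positivity, ?_⟩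
  filter_upwards [Ioo_mem_nhdsGT (show (0 : ℝ) < ρ / 4 by positivity)] with r hr
  obtain ⟨hr0, hr1⟩ := hr
  have hterm : ∀ j, ‖(r : ℂ) ^ (j + 1) • A j‖ ≤ C₀ * (2 / ρ) ^ (N + 1) * r * (1 / 2) ^ j := by
    intro j
    have h1 : ‖P (j + (N + 1))‖ ≤ C₀ / ρ ^ (j + (N + 1)) := by
      rw [le_div_iff₀ (by positivity)]; exact hbound _
    have h2 : ‖A j‖ ≤ 2 ^ (j + (N + 1)) * (C₀ / ρ ^ (j + (N + 1))) :=
      (hA j).trans (by gcongr)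
    have h3 : (2 / ρ * r) ^ j ≤ (1 / 2 : ℝ) ^ j := by
      gcongr
      rw [div_mul_eq_mul_div, div_le_iff₀ hρ']; linarith
    rw [norm_smul, norm_pow, Complex.norm_real, Real.norm_of_nonneg hr0.le]
    calc r ^ (j + 1) * ‖A j‖ ≤ r ^ (j + 1) * (2 ^ (j + (N + 1)) * (C₀ / ρ ^ (j + (N + 1)))) := by
          gcongr
      _ = C₀ * (2 / ρ) ^ (N + 1) * r * (2 / ρ * r) ^ j := by
          rw [mul_pow, div_pow, div_pow, pow_add, pow_add, pow_add]; field_simp; ring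
      _ ≤ _ := by gcongr
  have hgeo := (hasSum_geometric_two).mul_left (C₀ * (2 / ρ) ^ (N + 1) * r)
  have hsum : Summable (fun j => (r : ℂ) ^ (j + 1) • A j) :=
    Summable.of_norm_bounded hgeo.summable hterm
  refine ⟨∑' j, (r : ℂ) ^ (j + 1) • A j, ?_, fun p hp => ?_⟩
  · refine (tsum_of_norm_bounded hgeo hterm).trans_eq ?_
    ring
  · obtain ⟨E, hE⟩ := exists_evaluation hp
    have hin : (r : ℂ) • p ∈ Metric.eball (0 : ℂ × ℂ) R := by
      refine Metric.eball_subset_eball hρR.le ?_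
      rw [Metric.eball_coe, mem_ball_zero_iff, norm_smul, Complex.norm_real,
        Real.norm_of_nonneg hr0.le]
      nlinarith [norm_nonneg p]
    have h1 := hR.hasSum hin
    rw [zero_add, ← hasSum_nat_add_iff' (N + 1)] at h1
    rw [Finset.sum_eq_zero (fun i hi => hzero i (by have := Finset.mem_range.mp hi; omega) _),
      sub_zero] at h1
    have h2 := (hsum.hasSum.mapL E).mul_left ((r : ℂ) ^ N)
    rw [hE] at h2
    refine h1.unique (h2.congr_fun ?_)
    intro j
    rw [map_smul, hE, hAev j p hp]
    have := (P (j + (N + 1))).map_smul_univ (fun _ => (r : ℂ)) (fun _ => p)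
    rw [this]
    simp
    ring

lemma ev_add {p : ℂ × ℂ} (hp : ‖p‖ ≤ 1) (a b : Ell1 Idx) : ev (a + b) p = ev a p + ev b p := by
  obtain ⟨E, hE⟩ := exists_evaluation hp
  rw [← hE, ← hE, ← hE, map_add]

lemma ev_smul (c : ℂ) (a : Ell1 Idx) (p : ℂ × ℂ) : ev (c • a) p = c * ev a p := by
  rw [ev, ev, ← tsum_mul_left]
  exact tsum_congr fun m => by simp [mul_assoc]

lemma hasSum_ev (a : Ell1 Idx) {p : ℂ × ℂ} (hp : ‖p‖ ≤ 1) :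
    HasSum (fun m : Idx => a m * mono m p) (ev a p) := by
  refine (Summable.of_norm_bounded (hasSum_norm_ell1 a).summable fun m => ?_).hasSum
  rw [norm_mul]
  exact mul_le_of_le_one_right (norm_nonneg _) (norm_mono_le hp m)

lemma norm_ev_le (a : Ell1 Idx) {p : ℂ × ℂ} (hp : ‖p‖ ≤ 1) : ‖ev a p‖ ≤ ‖a‖ * ‖p‖ ^ 2 := by
  refine tsum_of_norm_bounded ((hasSum_norm_ell1 a).mul_right _) fun m => ?_
  rw [norm_mul, mono, norm_mul, norm_pow, norm_pow]
  gcongr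
  calc ‖p.1‖ ^ m.1.1 * ‖p.2‖ ^ m.1.2 ≤ ‖p‖ ^ m.1.1 * ‖p‖ ^ m.1.2 := by
        gcongr
        · exact norm_fst_le p
        · exact norm_snd_le p
    _ = ‖p‖ ^ (m.1.1 + m.1.2) := (pow_add _ _ _).symm
    _ ≤ ‖p‖ ^ 2 := pow_le_pow_of_le_one (norm_nonneg _) hp m.2

lemma isBigO_ev (a : Ell1 Idx) : ev a =O[𝓝 0] fun p => ‖p‖ ^ 2 := by
  refine Asymptotics.IsBigO.of_bound ‖a‖ ?_
  filter_upwards [Metric.ball_mem_nhds (0 : ℂ × ℂ) one_pos] with p hp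
  have hp : ‖p‖ < 1 := by simpa using hp
  simpa using norm_ev_le a hp.le

/-- The differential of a monomial. -/
noncomputable def dmono (m : ℕ × ℕ) (p : ℂ × ℂ) : ℂ × ℂ →L[ℂ] ℂ :=
  ((m.1 : ℂ) * mono (m.1 - 1, m.2) p) • ContinuousLinearMap.fst ℂ ℂ ℂ +
    ((m.2 : ℂ) * mono (m.1, m.2 - 1) p) • ContinuousLinearMap.snd ℂ ℂ ℂ

lemma hasFDerivAt_mono (m : ℕ × ℕ) (p : ℂ × ℂ) : HasFDerivAt (mono m) (dmono m p) p := by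
  have h1 : HasFDerivAt (fun q : ℂ × ℂ => q.1) (ContinuousLinearMap.fst ℂ ℂ ℂ) p := hasFDerivAt_fst
  have h2 : HasFDerivAt (fun q : ℂ × ℂ => q.2) (ContinuousLinearMap.snd ℂ ℂ ℂ) p := hasFDerivAt_snd
  refine ((h1.pow m.1).mul (h2.pow m.2)).congr_fderiv ?_
  ext <;> simp [dmono, mono] <;> ring

lemma norm_dmono_le (m : ℕ × ℕ) {p : ℂ × ℂ} (hp : ‖p‖ ≤ 1) : ‖dmono m p‖ ≤ m.1 + m.2 := by
  refine (norm_add_le _ _).trans ?_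
  rw [norm_smul, norm_smul, norm_mul, norm_mul, Complex.norm_natCast, Complex.norm_natCast]
  have h1 := norm_mono_le hp (m.1 - 1, m.2)
  have h2 := norm_mono_le hp (m.1, m.2 - 1)
  have h3 := ContinuousLinearMap.norm_fst_le ℂ ℂ ℂ
  have h4 := ContinuousLinearMap.norm_snd_le ℂ ℂ ℂ
  have e1 : (m.1 : ℝ) * ‖mono (m.1 - 1, m.2) p‖ * ‖ContinuousLinearMap.fst ℂ ℂ ℂ‖ ≤ m.1 * 1 * 1 := by
    gcongr
  have e2 : (m.2 : ℝ) * ‖mono (m.1, m.2 - 1) p‖ * ‖ContinuousLinearMap.snd ℂ ℂ ℂ‖ ≤ m.2 * 1 * 1 := by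
    gcongr
  linarith

/-- The degree of a monomial, as a complex number. -/
def deg (m : Idx) : ℂ := m.1.1 + m.1.2

lemma deg_eq (m : Idx) : deg m = ((m.1.1 + m.1.2 : ℕ) : ℂ) := by simp [deg]

lemma norm_deg (m : Idx) : ‖deg m‖ = m.1.1 + m.1.2 := by
  rw [deg_eq, Complex.norm_natCast]; simp

lemma norm_deg_ge (m : Idx) : 2 ≤ ‖deg m‖ := by
  rw [norm_deg]; exact_mod_cast m.2

lemma deg_ne_zero (m : Idx) : deg m ≠ 0 := by
  rw [← norm_pos_iff]; linarith [norm_deg_ge m]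

lemma hasFDerivAt_ev (h : Ell1 Idx) (s : Idx → ℂ) {C : ℝ} (hs : ∀ m, ‖s m‖ ≤ C) :
    ∃ b : Ell1 Idx, ∀ q : ℂ × ℂ, ‖q‖ < 1 → 
      HasSum (fun m => h m * (s m / deg m) * mono m q) (ev b q) ∧
      ∃ D : ℂ × ℂ →L[ℂ] ℂ, HasFDerivAt (ev b) D q ∧
        ∀ v, HasSum (fun m => h m * (s m / deg m) * dmono m q v) (D v) := by
  have hquot : ∀ m, ‖s m / deg m‖ ≤ C := fun m => by
    rw [norm_div]
    exact (div_le_self (norm_nonneg _) (by linarith [norm_deg_ge m])).trans (hs m)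
  have hC : 0 ≤ C := (norm_nonneg _).trans (hs ⟨(2, 0), le_rfl⟩)
  obtain ⟨B, -, hB⟩ := exists_ell1_lift
    (fun m : Idx => (s m / deg m) • (lp.single 1 m 1 : Ell1 Idx)) C hC (fun m => by
      rw [norm_smul, norm_single_one, mul_one]; exact hquot m)
  have hval : ∀ q : ℂ × ℂ, ‖q‖ < 1 →
      HasSum (fun m => h m * (s m / deg m) * mono m q) (ev (B h) q) := by
    intro q hq
    obtain ⟨E, hE⟩ := exists_evaluation hq.le
    have := (hB h).mapL E
    rw [hE] at this
    refine this.congr_fun fun m => ?_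
    rw [map_smul, map_smul, hE, ev_single]
    simp [mul_assoc]
  refine ⟨B h, fun q hq => ⟨hval q hq, ?_⟩⟩
  have hu : Summable (fun m => ‖h m‖ * C) := ((hasSum_norm_ell1 h).mul_right C).summable
  have hbound : ∀ (m : Idx) (x : ℂ × ℂ), x ∈ Metric.ball (0 : ℂ × ℂ) 1 →
      ‖(h m * (s m / deg m)) • dmono m x‖ ≤ ‖h m‖ * C := by
    intro m x hx
    have hx : ‖x‖ < 1 := by simpa using hx
    have h1 := norm_dmono_le m.1 hx.le
    rw [← norm_deg] at h1
    rw [norm_smul, norm_mul, norm_div, mul_assoc]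
    have h0 : 0 < ‖deg m‖ := by linarith [norm_deg_ge m]
    gcongr
    calc ‖s m‖ / ‖deg m‖ * ‖dmono m x‖ ≤ ‖s m‖ / ‖deg m‖ * ‖deg m‖ := by gcongr
      _ = ‖s m‖ := by field_simp
      _ ≤ C := hs m
  have hq' : q ∈ Metric.ball (0 : ℂ × ℂ) 1 := by simpa using hq
  have hd := hasFDerivAt_tsum_of_isPreconnected (𝕜 := ℂ) hu Metric.isOpen_ball
    (convex_ball (0 : ℂ × ℂ) 1).isPreconnected
    (f := fun m : Idx => fun x => (h m * (s m / deg m)) • mono m x)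
    (fun m x _ => (hasFDerivAt_mono m.1 x).fun_const_smul _) hbound hq'
    (hval q hq).summable hq'
  refine ⟨_, hd.congr_of_eventuallyEq ?_, fun v => ?_⟩
  · filter_upwards [Metric.isOpen_ball.mem_nhds hq'] with x hx
    exact (hval x (by simpa using hx)).tsum_eq.symm
  · have hs' : Summable fun m => (h m * (s m / deg m)) • dmono m.1 q :=
      Summable.of_norm_bounded hu fun m => hbound m q hq'
    have := hs'.hasSum.mapL (ContinuousLinearMap.apply ℂ ℂ v)
    simpa using this

lemma exists_remainder_operator (R₁ R₂ : Ell1 Idx) (lam₁ lam₂ ε μ : ℂ) {C : ℝ} (θ : ℂ) (m₀ : Idx)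
    (s : Idx → ℂ) (hs : ∀ m, ‖s m‖ ≤ C)
    (hs' : ∀ m : Idx, s m * (m.1.1 * lam₁ + m.1.2 * lam₂ - μ)
      = deg m * (1 - if m = m₀ then θ else 0)) :
    ∃ T : Ell1 Idx →L[ℂ] Ell1 Idx, ‖T‖ ≤ C * (‖R₁‖ + ‖ε‖ + ‖R₂‖) ∧
      ∀ h : Ell1 Idx, ∃ b : Ell1 Idx, ∀ q : ℂ × ℂ, ‖q‖ < 1 → ∃ D : ℂ × ℂ →L[ℂ] ℂ,
        HasFDerivAt (ev b) D q ∧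
        D (lam₁ * q.1 + ε * q.2 + ev R₁ q, lam₂ * q.2 + ev R₂ q)
          = μ * ev b q + (ev h q - θ * h m₀ * mono m₀ q + ev (T h) q) := by
  have hC : 0 ≤ C := (norm_nonneg _).trans (hs m₀)
  choose S₁ hS₁ hS₁' using fun m : Idx => exists_shift R₁ (m.1.1 - 1) m.1.2
  choose S₂ hS₂ hS₂' using fun m : Idx => exists_shift R₂ m.1.1 (m.1.2 - 1)
  let N : Idx → Idx := fun m => ⟨(m.1.1 - 1, m.1.2 + 1), by have := m.2; simp only; omega⟩
  let t : Idx → Ell1 Idx := fun m => (m.1.1 / deg m) • (S₁ m + ε • lp.single 1 (N m) 1)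
    + (m.1.2 / deg m) • S₂ m
  have hq1 : ∀ m : Idx, ‖(m.1.1 : ℂ) / deg m‖ ≤ 1 := fun m => by
    rw [norm_div, norm_deg, Complex.norm_natCast]
    exact div_le_one_of_le₀ (by simp) (by positivity)
  have hq2 : ∀ m : Idx, ‖(m.1.2 : ℂ) / deg m‖ ≤ 1 := fun m => by
    rw [norm_div, norm_deg, Complex.norm_natCast]
    exact div_le_one_of_le₀ (by simp) (by positivity)
  have ht : ∀ m, ‖t m‖ ≤ ‖R₁‖ + ‖ε‖ + ‖R₂‖ := fun m => by
    refine (norm_add_le _ _).trans ?_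
    rw [norm_smul, norm_smul]
    have e1 : ‖S₁ m + ε • (lp.single 1 (N m) 1 : Ell1 Idx)‖ ≤ ‖R₁‖ + ‖ε‖ := by
      refine (norm_add_le _ _).trans ?_
      rw [norm_smul, norm_single_one, mul_one]
      gcongr; exact hS₁ m
    exact add_le_add ((mul_le_of_le_one_left (norm_nonneg _) (hq1 m)).trans e1)
      ((mul_le_of_le_one_left (norm_nonneg _) (hq2 m)).trans (hS₂ m))
  obtain ⟨T, hT, hT'⟩ := exists_ell1_lift (fun m => s m • t m)
    (C * (‖R₁‖ + ‖ε‖ + ‖R₂‖)) (by positivity) (fun m => by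
      rw [norm_smul]
      have := ht m
      have := hs m
      gcongr)
  refine ⟨T, hT, fun h => ?_⟩
  obtain ⟨b, hb⟩ := hasFDerivAt_ev h s hs
  refine ⟨b, fun q hq => ?_⟩
  obtain ⟨hval, D, hD, hDv⟩ := hb q hq
  refine ⟨D, hD, ?_⟩
  obtain ⟨E, hE⟩ := exists_evaluation hq.le
  have h1 := (hT' h).mapL E
  rw [hE] at h1
  have h2 : HasSum (fun m => if m = m₀ then θ * h m₀ * mono m₀ q else 0)
      (θ * h m₀ * mono m₀ q) := hasSum_ite_eq m₀ _
  refine (hDv _).unique (((hval.mul_left μ).add (((hasSum_ev h hq.le).sub h2).add h1)).congr_fun ?_)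
  intro m
  have hd := deg_ne_zero m
  have e1 : (m.1.1 : ℂ) * mono (m.1.1 - 1, m.1.2) q * q.1 = m.1.1 * mono m q := by
    rcases Nat.eq_zero_or_pos m.1.1 with h0 | h0
    · simp [h0]
    · simp only [mono]
      obtain ⟨n, hn⟩ := Nat.exists_eq_succ_of_ne_zero h0.ne'
      rw [hn]; simp [pow_succ]; ring
  have e2 : (m.1.2 : ℂ) * mono (m.1.1, m.1.2 - 1) q * q.2 = m.1.2 * mono m q := by
    rcases Nat.eq_zero_or_pos m.1.2 with h0 | h0
    · simp [h0]
    · simp only [mono]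
      obtain ⟨n, hn⟩ := Nat.exists_eq_succ_of_ne_zero h0.ne'
      rw [hn]; simp [pow_succ]; ring
  have e3 : mono (m.1.1 - 1, m.1.2) q * q.2 = mono (N m) q := by
    simp only [mono, N]; ring
  have e4 : E (t m) = m.1.1 / deg m * (mono (m.1.1 - 1, m.1.2) q * ev R₁ q + ε * mono (N m) q)
      + m.1.2 / deg m * (mono (m.1.1, m.1.2 - 1) q * ev R₂ q) := by
    simp only [t, map_add, map_smul, smul_eq_mul]
    simp only [hE, ev_single, hS₁' m q hq.le, hS₂' m q hq.le]
  have e5 : (if m = m₀ then θ * h m₀ * mono m₀ q else 0)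
      = (if m = m₀ then θ else 0) * h m * mono m q := by
    split_ifs with hm
    · rw [hm]
    · simp
  have e6 := hs' m
  rw [map_smul, map_smul, e4, e5]
  generalize (if m = m₀ then θ else 0) = χ at *
  simp only [dmono, add_apply, smul_apply,
    ContinuousLinearMap.coe_fst', ContinuousLinearMap.coe_snd', smul_eq_mul]
  rw [← e3]
  generalize mono (m.1.1 - 1, m.1.2) q = A₁ at *
  generalize mono (m.1.1, m.1.2 - 1) q = A₂ at *
  generalize mono m q = A at *
  have e7 : s m / deg m * (m.1.1 * lam₁ + m.1.2 * lam₂ - μ) = 1 - χ := by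
    rw [div_mul_eq_mul_div, e6]; field_simp
  linear_combination (h m * (s m / deg m) * lam₁) * e1 + (h m * (s m / deg m) * lam₂) * e2
    + h m * A * e7

lemma exists_solution_of_norm_lt_one {E : Type*} [NormedAddCommGroup E] [NormedSpace ℂ E]
    [CompleteSpace E] (P : E →L[ℂ] E) (hP : ‖P‖ < 1) (w : E) : ∃ h, h + P h = w := by
  let u := Units.oneSub (-P) (by rwa [norm_neg])
  refine ⟨(↑u⁻¹ : E →L[ℂ] E) w, ?_⟩
  have h1 : (u : E →L[ℂ] E) * (↑u⁻¹ : E →L[ℂ] E) = 1 := u.mul_inv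
  have h2 : (u : E →L[ℂ] E) = 1 + P := by simp [u]
  rw [h2] at h1
  have := congrArg (fun L : E →L[ℂ] E => L w) h1
  simpa using this

/-- Analytic solvability of the homological equation `X·ψ = μψ + w + c g`, where the constant `c`
absorbs the only possible resonance. -/
theorem exists_homological_solution {R₁ R₂ w g : ℂ × ℂ → ℂ} {lam₁ lam₂ ε μ : ℂ} {m₀ : Idx} {δ : ℝ}
    (hR₁ : AnalyticAt ℂ R₁ 0) (hR₁' : R₁ =O[𝓝 0] fun p => ‖p‖ ^ 2)
    (hR₂ : AnalyticAt ℂ R₂ 0) (hR₂' : R₂ =O[𝓝 0] fun p => ‖p‖ ^ 2)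
    (hw : AnalyticAt ℂ w 0) (hw' : w =O[𝓝 0] fun p => ‖p‖ ^ 2)
    (hg : AnalyticAt ℂ g 0)
    (hg' : (fun p => g p - mono m₀ p) =O[𝓝 0] fun p => ‖p‖ ^ (m₀.1.1 + m₀.1.2 + 1))
    (hδ : 0 < δ)
    (hnr : ∀ m : Idx, m ≠ m₀ → δ * ‖deg m‖ ≤ ‖m.1.1 * lam₁ + m.1.2 * lam₂ - μ‖)
    (hε : ‖ε‖ ≤ δ / 8) :
    ∃ (ψ : ℂ × ℂ → ℂ) (c : ℂ), AnalyticAt ℂ ψ 0 ∧ ψ =O[𝓝 0] (fun p => ‖p‖ ^ 2) ∧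
      (δ * ‖deg m₀‖ ≤ ‖m₀.1.1 * lam₁ + m₀.1.2 * lam₂ - μ‖ → c = 0) ∧
      ∀ᶠ p in 𝓝 0, fderiv ℂ ψ p (lam₁ * p.1 + ε * p.2 + R₁ p, lam₂ * p.2 + R₂ p)
        = μ * ψ p + w p + c * g p := by
  classical
  set k := m₀.1.1 + m₀.1.2 with hk
  have hk2 : 2 ≤ k := m₀.2
  let Good : Idx → Prop := fun m => δ * ‖deg m‖ ≤ ‖m.1.1 * lam₁ + m.1.2 * lam₂ - μ‖
  let θ : ℂ := if Good m₀ then 0 else 1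
  let s : Idx → ℂ := fun m => if Good m then deg m / (m.1.1 * lam₁ + m.1.2 * lam₂ - μ) else 0
  have hpos : ∀ m, Good m → 0 < ‖m.1.1 * lam₁ + m.1.2 * lam₂ - μ‖ := fun m hm =>
    lt_of_lt_of_le (by have := norm_deg_ge m; positivity) hm
  have hs : ∀ m, ‖s m‖ ≤ δ⁻¹ := fun m => by
    by_cases hm : Good m
    · simp only [s, hm, if_true, norm_div]
      rw [div_le_iff₀ (hpos m hm), inv_mul_eq_div, le_div_iff₀ hδ, mul_comm]
      exact hm
    · simp only [s, hm, if_false, norm_zero]; positivity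
  have hs' : ∀ m : Idx, s m * (m.1.1 * lam₁ + m.1.2 * lam₂ - μ)
      = deg m * (1 - if m = m₀ then θ else 0) := fun m => by
    by_cases hm : Good m
    · have h0 : (m.1.1 * lam₁ + m.1.2 * lam₂ - μ) ≠ 0 := norm_pos_iff.mp (hpos m hm)
      have : (if m = m₀ then θ else 0) = 0 := by
        split_ifs with h
        · subst h; simp [θ, hm]
        · rfl
      rw [this]
      simp only [s, hm, if_true]
      field_simp
      simp
    · have h : m = m₀ := by by_contra h; exact hm (hnr m h)
      subst h
      simp [s, hm, θ]
  obtain ⟨C₁, hC₁, h₁⟩ := exists_coeffs hR₁ le_rfl hR₁'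
  obtain ⟨C₂, hC₂, h₂⟩ := exists_coeffs hR₂ le_rfl hR₂'
  obtain ⟨C₃, hC₃, h₃⟩ := exists_coeffs hw le_rfl hw'
  have hmono : AnalyticAt ℂ (mono m₀) 0 := by
    unfold mono
    exact (analyticAt_fst.pow _).mul (analyticAt_snd.pow _)
  obtain ⟨C₄, hC₄, h₄⟩ := exists_coeffs (hg.sub hmono) (show 1 ≤ k by omega) hg'
  have hsmall : ∀ᶠ r in 𝓝[>] (0 : ℝ), (C₁ + C₂ + δ * C₄) * r < δ / 8 := by
    have : Tendsto (fun r : ℝ => (C₁ + C₂ + δ * C₄) * r) (𝓝[>] 0) (𝓝 0) := by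
      have h : Tendsto (fun r : ℝ => (C₁ + C₂ + δ * C₄) * r) (𝓝 0)
        (𝓝 ((C₁ + C₂ + δ * C₄) * 0)) := (continuous_const.mul continuous_id).tendsto 0
      rw [mul_zero] at h
      exact h.mono_left nhdsWithin_le_nhds
    exact this.eventually_lt_const (by positivity)
  obtain ⟨r, ⟨a₁, ha₁, ha₁'⟩, ⟨a₂, ha₂, ha₂'⟩, ⟨a₃, ha₃, ha₃'⟩, ⟨a₄, ha₄, ha₄'⟩, hr, hr0⟩ :=
    (h₁.and (h₂.and (h₃.and (h₄.and (hsmall.and self_mem_nhdsWithin))))).exists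
  have hr0 : 0 < r := hr0
  have hrC : (r : ℂ) ≠ 0 := by exact_mod_cast hr0.ne'
  obtain ⟨T, hT, hT'⟩ := exists_remainder_operator a₁ a₂ lam₁ lam₂ ε μ θ m₀ s hs hs'
  let cm : Ell1 Idx →L[ℂ] ℂ := lp.evalCLM ℂ (fun _ : Idx => ℂ) 1 m₀
  have hcm : ‖cm‖ ≤ 1 := ContinuousLinearMap.opNorm_le_bound _ zero_le_one fun b => by
    rw [one_mul]; exact norm_ell1_apply_le b m₀
  have hθ : ‖θ‖ ≤ 1 := by by_cases h : Good m₀ <;> simp [θ, h]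
  have hterms : C₁ * r + C₂ * r + δ * (C₄ * r) < δ / 8 := by linarith
  have p1 : 0 ≤ C₁ * r := by positivity
  have p2 : 0 ≤ C₂ * r := by positivity
  have p3 : 0 ≤ δ * (C₄ * r) := by positivity
  have ha₄8 : ‖a₄‖ ≤ 1 / 8 := by
    refine ha₄.trans ?_
    have : δ * (C₄ * r) < δ * (1 / 8) := by linarith
    exact (lt_of_mul_lt_mul_left this hδ.le).le
  have hTn : ‖T‖ ≤ 1 / 4 := by
    refine hT.trans ?_
    rw [inv_mul_le_iff₀ hδ]
    linarith
  have hQ : ‖θ • cm.smulRight a₄‖ ≤ 1 / 8 := by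
    rw [norm_smul, ContinuousLinearMap.norm_smulRight_apply]
    calc ‖θ‖ * (‖cm‖ * ‖a₄‖) ≤ 1 * (1 * (1 / 8)) := by gcongr
      _ = 1 / 8 := by ring
  obtain ⟨h, hh⟩ := exists_solution_of_norm_lt_one (T + θ • cm.smulRight a₄)
    (by linarith [norm_add_le T (θ • cm.smulRight a₄)]) a₃
  obtain ⟨b, hb⟩ := hT' h
  have hscale : ∀ p : ℂ × ℂ, (r : ℂ) • ((r : ℂ)⁻¹ • p) = p := fun p => smul_inv_smul₀ hrC p
  refine ⟨fun p => r * ev b ((r : ℂ)⁻¹ • p), -(θ * h m₀ * r / r ^ k), ?_, ?_, ?_, ?_⟩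
  · have h1 : AnalyticAt ℂ (fun p : ℂ × ℂ => (r : ℂ)⁻¹ • p) 0 := by
      fun_prop
    refine analyticAt_const.mul (AnalyticAt.fun_comp (g := ev b) ?_ h1)
    rw [smul_zero]; exact analyticAt_ev b
  · have h1 : Tendsto (fun p : ℂ × ℂ => (r : ℂ)⁻¹ • p) (𝓝 0) (𝓝 0) := by
      have : Continuous (fun p : ℂ × ℂ => (r : ℂ)⁻¹ • p) := by fun_prop
      simpa using this.tendsto 0
    refine (((isBigO_ev b).comp_tendsto h1).const_mul_left (r : ℂ)).trans ?_
    refine Asymptotics.IsBigO.of_bound (‖(r : ℂ)⁻¹‖ ^ 2) (Eventually.of_forall fun p => ?_)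
    simp [norm_smul, mul_pow]
  · intro hgood
    have : θ = 0 := by simp only [θ]; rw [if_pos hgood]
    simp [this]
  · filter_upwards [Metric.ball_mem_nhds (0 : ℂ × ℂ) hr0] with p hp
    have hp : ‖p‖ < r := by simpa using hp
    obtain ⟨q, rfl⟩ : ∃ q : ℂ × ℂ, p = (r : ℂ) • q := ⟨_, (hscale p).symm⟩
    have hinv : ∀ q : ℂ × ℂ, (r : ℂ)⁻¹ • ((r : ℂ) • q) = q := fun q => inv_smul_smul₀ hrC q
    have hq : ‖q‖ < 1 := by
      rw [norm_smul, Complex.norm_real, Real.norm_of_nonneg hr0.le] at hp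
      nlinarith
    obtain ⟨D, hD, hDv⟩ := hb q hq
    have hψ : HasFDerivAt (fun p => (r : ℂ) * ev b ((r : ℂ)⁻¹ • p)) D ((r : ℂ) • q) := by
      have h1 : HasFDerivAt (fun p : ℂ × ℂ => (r : ℂ)⁻¹ • p)
          ((r : ℂ)⁻¹ • ContinuousLinearMap.id ℂ (ℂ × ℂ)) ((r : ℂ) • q) :=
        (hasFDerivAt_id _).fun_const_smul _
      have h2 : HasFDerivAt (ev b) D ((r : ℂ)⁻¹ • ((r : ℂ) • q)) := by rwa [hinv]
      refine ((h2.comp _ h1).const_mul (r : ℂ)).congr_fderiv ?_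
      ext <;> simp [hrC]
    rw [hψ.fderiv]
    have hv : ((lam₁ * ((r : ℂ) • q).1 + ε * ((r : ℂ) • q).2 + R₁ ((r : ℂ) • q),
        lam₂ * ((r : ℂ) • q).2 + R₂ ((r : ℂ) • q)) : ℂ × ℂ)
        = (r : ℂ) • (lam₁ * q.1 + ε * q.2 + ev a₁ q, lam₂ * q.2 + ev a₂ q) := by
      rw [ha₁' q hq.le, ha₂' q hq.le]
      ext <;> simp <;> ring
    rw [hv, map_smul, hDv, hinv, ha₃' q hq.le]
    have e1 : g ((r : ℂ) • q) = r ^ k * ev a₄ q + r ^ k * mono m₀ q := by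
      have := ha₄' q hq.le
      have h5 : mono m₀ ((r : ℂ) • q) = r ^ k * mono m₀ q := by
        simp only [mono, hk, Prod.smul_fst, Prod.smul_snd, smul_eq_mul, mul_pow, pow_add]; ring
      rw [← this, ← h5]; simp
    have e2 : ev a₃ q = ev h q + (ev (T h) q + θ * (h m₀ * ev a₄ q)) := by
      rw [← hh, ev_add hq.le, add_apply, ev_add hq.le, smul_apply, ev_smul,
        ContinuousLinearMap.smulRight_apply, ev_smul]
      rfl
    rw [e1, e2, smul_eq_mul]
    field_simp
    ring

lemma exists_lower_bound {lam₁ lam₂ : ℂ} (hlam₁ : lam₁ ≠ 0)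
    (hratio : ∀ r : ℝ, r ≤ 0 → lam₂ ≠ (r : ℂ) * lam₁) :
    ∃ δ : ℝ, 0 < δ ∧ ∀ i j : ℕ, δ * (i + j) ≤ ‖i * lam₁ + j * lam₂‖ := by
  have hcont : ContinuousOn (fun t : ℝ => ‖(t : ℂ) * lam₁ + (1 - t) * lam₂‖) (Set.Icc 0 1) := by
    fun_prop
  obtain ⟨t, ht, hmin⟩ := isCompact_Icc.exists_isMinOn (Set.nonempty_Icc.mpr zero_le_one) hcont
  refine ⟨‖(t : ℂ) * lam₁ + (1 - t) * lam₂‖, norm_pos_iff.mpr fun h0 => ?_, fun i j => ?_⟩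
  · rcases eq_or_lt_of_le ht.2 with h1 | h1
    · subst h1; simp at h0; exact hlam₁ h0
    · have hne : (1 - (t : ℂ)) ≠ 0 := by
        rw [sub_ne_zero]; exact_mod_cast h1.ne'
      refine hratio (-(t / (1 - t))) (by have := ht.1; have := sub_pos.mpr h1
                                         simp only [Left.neg_nonpos_iff]; positivity) ?_
      push_cast
      field_simp
      linear_combination h0
  · rcases Nat.eq_zero_or_pos (i + j) with h | h
    · have hi : i = 0 := by omega
      have hj : j = 0 := by omega
      simp [hi, hj]
    · have hpos : (0 : ℝ) < i + j := by exact_mod_cast h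
      have hposC : (i : ℂ) + j ≠ 0 := by exact_mod_cast h.ne'
      have hmem : (i / (i + j) : ℝ) ∈ Set.Icc (0 : ℝ) 1 :=
        ⟨by positivity, div_le_one_of_le₀ (by simp) hpos.le⟩
      have := hmin hmem
      simp only [Set.mem_ofPred_eq] at this
      rw [← le_div_iff₀ hpos]
      refine this.trans_eq ?_
      have e : ‖(i : ℂ) + j‖ = i + j := by
        have := Complex.norm_natCast (i + j); push_cast at this; exact this
      conv_rhs => rw [← e, ← norm_div]
      congr 1
      push_cast
      field_simp
      ring

lemma exists_divisor_bound {lam₁ lam₂ : ℂ} (hlam₁ : lam₁ ≠ 0)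
    (hratio : ∀ r : ℝ, r ≤ 0 → lam₂ ≠ (r : ℂ) * lam₁) (μ : ℂ) :
    ∃ δ : ℝ, 0 < δ ∧ ∀ m : Idx, m.1.1 * lam₁ + m.1.2 * lam₂ ≠ μ →
      δ * ‖deg m‖ ≤ ‖m.1.1 * lam₁ + m.1.2 * lam₂ - μ‖ := by
  obtain ⟨δ, hδ, hbound⟩ := exists_lower_bound hlam₁ hratio
  obtain ⟨M, hM⟩ := exists_nat_gt (2 * ‖μ‖ / δ)
  have hfin : {m : Idx | m.1.1 + m.1.2 ≤ M}.Finite := by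
    refine Set.Finite.preimage (f := Subtype.val) Subtype.val_injective.injOn
      (s := {m : ℕ × ℕ | m.1 + m.2 ≤ M}) ?_
    refine ((Set.finite_Iic M).prod (Set.finite_Iic M)).subset fun m hm => ?_
    simp only [Set.mem_ofPred_eq] at hm
    exact ⟨by simp; omega, by simp; omega⟩
  have hsmall : ∀ S : Set Idx, S.Finite → ∃ η : ℝ, 0 < η ∧ ∀ m ∈ S,
      m.1.1 * lam₁ + m.1.2 * lam₂ ≠ μ → η * ‖deg m‖ ≤ ‖m.1.1 * lam₁ + m.1.2 * lam₂ - μ‖ := by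
    intro S hS
    induction S, hS using Set.Finite.induction_on with
    | empty => exact ⟨1, one_pos, by simp⟩
    | @insert m S _ _ ih =>
      obtain ⟨η, hη, h⟩ := ih
      have hdeg : 0 < ‖deg m‖ := by linarith [norm_deg_ge m]
      by_cases hm : m.1.1 * lam₁ + m.1.2 * lam₂ = μ
      · refine ⟨η, hη, ?_⟩
        rintro n (rfl | hn) hne
        · exact absurd hm hne
        · exact h n hn hne
      · have hpos : 0 < ‖m.1.1 * lam₁ + m.1.2 * lam₂ - μ‖ := norm_pos_iff.mpr (sub_ne_zero.mpr hm)
        refine ⟨min η (‖m.1.1 * lam₁ + m.1.2 * lam₂ - μ‖ / ‖deg m‖), by positivity, ?_⟩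
        rintro n (rfl | hn) hne
        · rw [← le_div_iff₀ hdeg]; exact min_le_right _ _
        · refine le_trans ?_ (h n hn hne)
          gcongr; exact min_le_left _ _
  obtain ⟨η, hη, hηb⟩ := hsmall _ hfin
  refine ⟨min η (δ / 2), by positivity, fun m hm => ?_⟩
  by_cases hmM : m.1.1 + m.1.2 ≤ M
  · refine le_trans ?_ (hηb m hmM hm)
    gcongr; exact min_le_left _ _
  · have h1 := hbound m.1.1 m.1.2
    rw [← norm_deg] at h1
    have h2 : (M : ℝ) ≤ ‖deg m‖ := by
      rw [norm_deg]; exact_mod_cast (not_le.mp hmM).le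
    have h3 : 2 * ‖μ‖ ≤ δ * ‖deg m‖ := by
      rw [div_lt_iff₀ hδ] at hM; nlinarith
    have h4 := norm_sub_norm_le (m.1.1 * lam₁ + m.1.2 * lam₂) μ
    have h5 : min η (δ / 2) * ‖deg m‖ ≤ δ / 2 * ‖deg m‖ := by gcongr; exact min_le_right _ _
    linarith

lemma isBigO_sq_of_hasFDerivAt_zero {f : ℂ × ℂ → ℂ} (hf : AnalyticAt ℂ f 0) (h0 : f 0 = 0)
    (hd : HasFDerivAt f (0 : ℂ × ℂ →L[ℂ] ℂ) 0) : f =O[𝓝 0] fun p => ‖p‖ ^ 2 := by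
  obtain ⟨P, hP⟩ := hf
  have h1 := hP.isBigO_sub_partialSum_pow 2
  have h2 := hP.hasFDerivAt.unique hd
  refine h1.congr_left fun y => ?_
  have e0 : P 0 (fun _ => y) = 0 := by rw [← h0]; exact hP.coeff_zero _
  have e1 : P 1 (fun _ => y) = 0 := by
    have := congrArg (fun L : ℂ × ℂ →L[ℂ] ℂ => L y) h2
    simp only [continuousMultilinearCurryFin1_apply, zero_apply] at this
    rw [← this]
    congr 1
  simp [FormalMultilinearSeries.partialSum, Finset.sum_range_succ, e0, e1]

/-- `X` is conjugate to `Z` near the origin by a germ of biholomorphism fixing the origin. -/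
def Conj (X Z : ℂ × ℂ → ℂ × ℂ) : Prop :=
  ∃ Φ : ℂ × ℂ → ℂ × ℂ, AnalyticAt ℂ Φ 0 ∧ Φ 0 = 0 ∧
    LinearMap.det ((fderiv ℂ Φ 0).toLinearMap) ≠ 0 ∧
    ∀ᶠ p in 𝓝 (0 : ℂ × ℂ), fderiv ℂ Φ p (X p) = Z (Φ p)

lemma Conj.congr_linear {X Y Z W : ℂ × ℂ → ℂ × ℂ} (P A : (ℂ × ℂ) ≃L[ℂ] (ℂ × ℂ))
    (hY : ∀ p, Y (P p) = P (X p)) (hZ : ∀ q, A (Z q) = W (A q)) (h : Conj Y Z) : Conj X W := by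
  obtain ⟨Φ, hΦ, hΦ0, hdet, hconj⟩ := h
  have hP0 : P 0 = 0 := map_zero P
  have hd : ∀ p, AnalyticAt ℂ Φ (P p) → HasFDerivAt (fun p => A (Φ (P p)))
      ((A : ℂ × ℂ →L[ℂ] ℂ × ℂ).comp ((fderiv ℂ Φ (P p)).comp (P : ℂ × ℂ →L[ℂ] ℂ × ℂ))) p :=
    fun p hp => A.hasFDerivAt.comp p (hp.differentiableAt.hasFDerivAt.comp p P.hasFDerivAt)
  have hΦP : AnalyticAt ℂ Φ (P 0) := by rwa [hP0]
  refine ⟨fun p => A (Φ (P p)), ?_, ?_, ?_, ?_⟩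
  · have h1 : AnalyticAt ℂ (fun p => Φ (P p)) 0 := hΦP.fun_comp (P.analyticAt 0)
    exact (A.analyticAt _).fun_comp h1
  · simp [hP0, hΦ0]
  · rw [(hd 0 hΦP).fderiv, hP0]
    have e : ((A : ℂ × ℂ →L[ℂ] ℂ × ℂ).comp ((fderiv ℂ Φ 0).comp
        (P : ℂ × ℂ →L[ℂ] ℂ × ℂ))).toLinearMap
        = (A.toLinearEquiv : ℂ × ℂ →ₗ[ℂ] ℂ × ℂ) ∘ₗ ((fderiv ℂ Φ 0).toLinearMap ∘ₗ
          (P.toLinearEquiv : ℂ × ℂ →ₗ[ℂ] ℂ × ℂ)) := rfl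
    rw [e, LinearMap.det_comp, LinearMap.det_comp]
    exact mul_ne_zero A.toLinearEquiv.isUnit_det'.ne_zero
      (mul_ne_zero hdet P.toLinearEquiv.isUnit_det'.ne_zero)
  · have ht : Tendsto P (𝓝 0) (𝓝 0) := by simpa using P.continuous.tendsto 0
    filter_upwards [ht.eventually hconj, ht.eventually hΦ.eventually_analyticAt] with p hp hp'
    rw [(hd p hp').fderiv]
    change A (fderiv ℂ Φ (P p) (P (X p))) = _
    rw [← hY, hp, hZ]

lemma conj_of_perturbation {Y Z : ℂ × ℂ → ℂ × ℂ} {ψ₁ ψ₂ : ℂ × ℂ → ℂ}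
    (h₁ : AnalyticAt ℂ ψ₁ 0) (h₁' : ψ₁ =O[𝓝 0] fun p => ‖p‖ ^ 2)
    (h₂ : AnalyticAt ℂ ψ₂ 0) (h₂' : ψ₂ =O[𝓝 0] fun p => ‖p‖ ^ 2)
    (hc₁ : ∀ᶠ p in 𝓝 0, (Y p).1 + fderiv ℂ ψ₁ p (Y p) = (Z (p.1 + ψ₁ p, p.2 + ψ₂ p)).1)
    (hc₂ : ∀ᶠ p in 𝓝 0, (Y p).2 + fderiv ℂ ψ₂ p (Y p) = (Z (p.1 + ψ₁ p, p.2 + ψ₂ p)).2) :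
    Conj Y Z := by
  have hz : ∀ ψ : ℂ × ℂ → ℂ, (ψ =O[𝓝 0] fun p => ‖p‖ ^ 2) → ψ 0 = 0 ∧ fderiv ℂ ψ 0 = 0 := by
    intro ψ h
    refine ⟨Asymptotics.IsBigO.eq_zero_of_norm_pow (n := 2) (x₀ := 0)
      (by simpa using h) (by norm_num), ?_⟩
    have : HasFDerivAt ψ (0 : ℂ × ℂ →L[ℂ] ℂ) 0 :=
      Asymptotics.IsBigO.hasFDerivAt (n := 2) (by simpa using h) (by norm_num)
    exact this.fderiv
  obtain ⟨z₁, d₁⟩ := hz ψ₁ h₁'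
  obtain ⟨z₂, d₂⟩ := hz ψ₂ h₂'
  have hd : ∀ p, AnalyticAt ℂ ψ₁ p → AnalyticAt ℂ ψ₂ p →
      HasFDerivAt (fun p : ℂ × ℂ => (p.1 + ψ₁ p, p.2 + ψ₂ p))
        ((ContinuousLinearMap.fst ℂ ℂ ℂ + fderiv ℂ ψ₁ p).prod
          (ContinuousLinearMap.snd ℂ ℂ ℂ + fderiv ℂ ψ₂ p)) p := fun p hp hp' =>
    (hasFDerivAt_fst.add hp.differentiableAt.hasFDerivAt).prodMk
      (hasFDerivAt_snd.add hp'.differentiableAt.hasFDerivAt)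
  refine ⟨fun p => (p.1 + ψ₁ p, p.2 + ψ₂ p), (analyticAt_fst.add h₁).prod (analyticAt_snd.add h₂),
    by simp [z₁, z₂], ?_, ?_⟩
  · rw [(hd 0 h₁ h₂).fderiv, d₁, d₂]
    have e : ((ContinuousLinearMap.fst ℂ ℂ ℂ + 0).prod
      (ContinuousLinearMap.snd ℂ ℂ ℂ + 0)).toLinearMap = LinearMap.id := by ext <;> simp
    rw [e, LinearMap.det_id]
    exact one_ne_zero
  · filter_upwards [hc₁, hc₂, h₁.eventually_analyticAt, h₂.eventually_analyticAt] with p e₁ e₂ a₁ a₂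
    rw [(hd p a₁ a₂).fderiv]
    exact Prod.ext e₁ e₂

/-- The linear automorphism of the plane with rows `(s, t)` and `(s', t')`. -/
noncomputable def planeEquiv (s t s' t' : ℂ) (h : s * t' - s' * t ≠ 0) : (ℂ × ℂ) ≃L[ℂ] (ℂ × ℂ) :=
  LinearEquiv.toContinuousLinearEquiv
    { toFun := fun p => (s * p.1 + t * p.2, s' * p.1 + t' * p.2)
      invFun := fun q => ((t' * q.1 - t * q.2) / (s * t' - s' * t),
        (s * q.2 - s' * q.1) / (s * t' - s' * t))
      map_add' := fun p q => by ext <;> simp <;> ring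
      map_smul' := fun r p => by ext <;> simp <;> ring
      left_inv := fun p => by ext <;> simp only <;> rw [div_eq_iff h] <;> ring
      right_inv := fun q => by
        ext
        · simp only; rw [mul_div_assoc', mul_div_assoc', ← add_div, div_eq_iff h]; ring
        · simp only; rw [mul_div_assoc', mul_div_assoc', ← add_div, div_eq_iff h]; ring }

@[simp] lemma planeEquiv_apply (s t s' t' : ℂ) (h : s * t' - s' * t ≠ 0) (p : ℂ × ℂ) :
    planeEquiv s t s' t' h p = (s * p.1 + t * p.2, s' * p.1 + t' * p.2) := rfl

lemma exists_left_eigenvector {a b c d μ : ℂ} (h : (a - μ) * (d - μ) = b * c) :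
    ∃ s t : ℂ, (s ≠ 0 ∨ t ≠ 0) ∧ s * a + t * c = μ * s ∧ s * b + t * d = μ * t := by
  by_cases h1 : c = 0 ∧ a - μ = 0
  · obtain ⟨rfl, h1⟩ := h1
    by_cases h2 : d - μ = 0 ∧ b = 0
    · exact ⟨1, 0, by simp, by linear_combination h1, by simp [h2.2]⟩
    · refine ⟨d - μ, -b, by by_contra! h3; exact h2 ⟨h3.1, by simpa using h3.2⟩, ?_, by ring⟩
      linear_combination (d - μ) * h1
  · refine ⟨c, -(a - μ), ?_, by ring, by linear_combination -h⟩
    by_contra! h3; exact h1 ⟨h3.1, neg_eq_zero.mp h3.2⟩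

lemma exists_linear_normal_form (L : ℂ × ℂ →L[ℂ] ℂ × ℂ) {lam₁ lam₂ : ℂ}
    (hdet : LinearMap.det L.toLinearMap = lam₁ * lam₂)
    (htr : LinearMap.trace ℂ (ℂ × ℂ) L.toLinearMap = lam₁ + lam₂) :
    (∃ P : (ℂ × ℂ) ≃L[ℂ] (ℂ × ℂ), ∀ p, P (L p) = (lam₁ * (P p).1, lam₂ * (P p).2)) ∨
    (lam₁ = lam₂ ∧ ∀ ε : ℂ, ε ≠ 0 → ∃ P : (ℂ × ℂ) ≃L[ℂ] (ℂ × ℂ),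
      ∀ p, P (L p) = (lam₁ * (P p).1 + ε * (P p).2, lam₂ * (P p).2)) := by
  obtain ⟨a, c, hac⟩ : ∃ a c, L (1, 0) = (a, c) := ⟨_, _, rfl⟩
  obtain ⟨b, d, hbd⟩ : ∃ b d, L (0, 1) = (b, d) := ⟨_, _, rfl⟩
  have hL : ∀ p, L p = (a * p.1 + b * p.2, c * p.1 + d * p.2) := fun p => by
    have : p = p.1 • ((1, 0) : ℂ × ℂ) + p.2 • ((0, 1) : ℂ × ℂ) := by ext <;> simp
    conv_lhs => rw [this, map_add, map_smul, map_smul, hac, hbd]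
    ext <;> simp <;> ring
  rw [← LinearMap.det_toMatrix (Module.Basis.finTwoProd ℂ), Matrix.det_fin_two] at hdet
  rw [LinearMap.trace_eq_matrix_trace ℂ (Module.Basis.finTwoProd ℂ), Matrix.trace_fin_two] at htr
  simp [LinearMap.toMatrix_apply, hac, hbd] at hdet htr
  by_cases hne : lam₁ = lam₂
  · subst hne
    by_cases hb : b = 0
    · by_cases hc : c = 0
      · left
        subst hb hc
        have ha : a = lam₁ := by
          have : (a - lam₁) ^ 2 = 0 := by linear_combination a * htr - hdet
          simpa [sub_eq_zero] using this
        have hd : d = lam₁ := by linear_combination htr - ha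
        exact ⟨.refl ℂ _, fun p => by simp [hL, ha, hd]⟩
      · refine Or.inr ⟨rfl, fun ε hε => ⟨planeEquiv 0 1 (c / ε) ((d - lam₁) / ε)
          (by simp [hc, hε]), fun p => ?_⟩⟩
        ext
        · simp only [hL, planeEquiv_apply]; field_simp; ring
        · simp only [hL, planeEquiv_apply]; field_simp
          linear_combination c * p.1 * htr + p.2 * (d * htr - hdet)
    · refine Or.inr ⟨rfl, fun ε hε => ⟨planeEquiv 1 0 ((a - lam₁) / ε) (b / ε)
          (by simp [hb, hε]), fun p => ?_⟩⟩
      ext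
      · simp only [hL, planeEquiv_apply]; field_simp; ring
      · simp only [hL, planeEquiv_apply]; field_simp
        linear_combination b * p.2 * htr + p.1 * (a * htr - hdet)
  · left
    obtain ⟨s, t, h0, h1, h2⟩ := exists_left_eigenvector (a := a) (b := b) (c := c) (d := d)
      (μ := lam₁) (by linear_combination hdet - lam₁ * htr)
    obtain ⟨s', t', h0', h1', h2'⟩ := exists_left_eigenvector (a := a) (b := b) (c := c) (d := d)
      (μ := lam₂) (by linear_combination hdet - lam₂ * htr)
    have hne' : lam₁ - lam₂ ≠ 0 := sub_ne_zero.mpr hne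
    have hind : s * t' - s' * t ≠ 0 := by
      intro h
      have e1 : s * s' = 0 := by
        refine (mul_eq_zero.mp (?_ : (lam₁ - lam₂) * (s * s') = 0)).resolve_left hne'
        linear_combination s * h1' - s' * h1 - c * h
      have e2 : t * t' = 0 := by
        refine (mul_eq_zero.mp (?_ : (lam₁ - lam₂) * (t * t') = 0)).resolve_left hne'
        linear_combination t * h2' - t' * h2 + b * h
      rcases mul_eq_zero.mp e1 with hs | hs <;> rcases mul_eq_zero.mp e2 with ht | ht <;>
        simp_all
    refine ⟨planeEquiv s t s' t' hind, fun p => ?_⟩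
    ext
    · simp only [hL, planeEquiv_apply]; linear_combination p.1 * h1 + p.2 * h2
    · simp only [hL, planeEquiv_apply]; linear_combination p.1 * h1' + p.2 * h2'

lemma fst_isBigO_norm : (fun p : ℂ × ℂ => p.1) =O[𝓝 0] fun p => ‖p‖ :=
  .of_bound 1 (.of_forall fun p => by simpa using norm_fst_le p)

lemma pow_add_sub_pow_isBigO {ψ : ℂ × ℂ → ℂ} (h : ψ =O[𝓝 0] fun p => ‖p‖ ^ 2) (k : ℕ) :
    (fun p : ℂ × ℂ => (p.1 + ψ p) ^ k - p.1 ^ k) =O[𝓝 0] fun p => ‖p‖ ^ (k + 1) := by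
  have hψ : ψ =O[𝓝 0] fun p => ‖p‖ := by
    refine h.trans ?_
    have : (fun p : ℂ × ℂ => ‖p‖) =O[𝓝 0] fun _ => (1 : ℝ) :=
      (continuous_norm.tendsto (0 : ℂ × ℂ)).isBigO_one ℝ
    simpa [pow_two] using (Asymptotics.isBigO_refl (fun p : ℂ × ℂ => ‖p‖) (𝓝 0)).mul this
  induction k with
  | zero => simpa using Asymptotics.isBigO_zero _ _
  | succ k ih =>
    have h1 := (fst_isBigO_norm.add hψ).mul ih
    have h2 := h.mul (fst_isBigO_norm.pow k)
    refine ((h1.congr_right fun p => ?_).add (h2.congr_right fun p => ?_)).congr_left fun p => ?_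
    · exact (pow_succ' ‖p‖ (k + 1)).symm
    · rw [← pow_add]; congr 1; ring
    · ring

/-- The exponents of a quadratic monomial. -/
def sqIdx : Idx := ⟨(2, 0), le_rfl⟩

lemma exists_nonresonant_solution {R₁ R₂ w : ℂ × ℂ → ℂ} {lam₁ lam₂ ε μ : ℂ} {δ : ℝ}
    (hR₁ : AnalyticAt ℂ R₁ 0) (hR₁' : R₁ =O[𝓝 0] fun p => ‖p‖ ^ 2)
    (hR₂ : AnalyticAt ℂ R₂ 0) (hR₂' : R₂ =O[𝓝 0] fun p => ‖p‖ ^ 2)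
    (hw : AnalyticAt ℂ w 0) (hw' : w =O[𝓝 0] fun p => ‖p‖ ^ 2) (hδ : 0 < δ)
    (hnr : ∀ m : Idx, δ * ‖deg m‖ ≤ ‖m.1.1 * lam₁ + m.1.2 * lam₂ - μ‖) (hε : ‖ε‖ ≤ δ / 8) :
    ∃ ψ, AnalyticAt ℂ ψ 0 ∧ (ψ =O[𝓝 0] fun p => ‖p‖ ^ 2) ∧
      ∀ᶠ p in 𝓝 0, fderiv ℂ ψ p (lam₁ * p.1 + ε * p.2 + R₁ p, lam₂ * p.2 + R₂ p)
        = μ * ψ p + w p := by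
  obtain ⟨ψ, c, h1, h2, h3, h4⟩ := exists_homological_solution (m₀ := sqIdx) (g := mono sqIdx.1)
    hR₁ hR₁' hR₂ hR₂' hw hw' ((analyticAt_fst.pow _).mul (analyticAt_snd.pow _))
    (by simpa using Asymptotics.isBigO_zero _ _) hδ (fun m _ => hnr m) hε
  refine ⟨ψ, h1, h2, ?_⟩
  simpa [h3 (hnr _)] using h4

lemma conj_diagonal {R₁ R₂ : ℂ × ℂ → ℂ} {lam₁ lam₂ : ℂ} (hlam₁ : lam₁ ≠ 0)
    (hratio : ∀ r : ℝ, r ≤ 0 → lam₂ ≠ (r : ℂ) * lam₁)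
    (hR₁ : AnalyticAt ℂ R₁ 0) (hR₁' : R₁ =O[𝓝 0] fun p => ‖p‖ ^ 2)
    (hR₂ : AnalyticAt ℂ R₂ 0) (hR₂' : R₂ =O[𝓝 0] fun p => ‖p‖ ^ 2)
    (hnr₁ : ∀ m : Idx, m.1.1 * lam₁ + m.1.2 * lam₂ ≠ lam₁)
    (hnr₂ : ∀ m : Idx, m.1.1 * lam₁ + m.1.2 * lam₂ ≠ lam₂) :
    Conj (fun p => (lam₁ * p.1 + R₁ p, lam₂ * p.2 + R₂ p))
      (fun q => (lam₁ * q.1, lam₂ * q.2)) := by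
  obtain ⟨δ₁, hδ₁, hb₁⟩ := exists_divisor_bound hlam₁ hratio lam₁
  obtain ⟨δ₂, hδ₂, hb₂⟩ := exists_divisor_bound hlam₁ hratio lam₂
  obtain ⟨ψ₁, a₁, o₁, e₁⟩ := exists_nonresonant_solution (ε := 0) hR₁ hR₁' hR₂ hR₂' hR₁.neg
    hR₁'.neg_left hδ₁ (fun m => hb₁ m (hnr₁ m)) (by simp; positivity)
  obtain ⟨ψ₂, a₂, o₂, e₂⟩ := exists_nonresonant_solution (ε := 0) hR₁ hR₁' hR₂ hR₂' hR₂.neg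
    hR₂'.neg_left hδ₂ (fun m => hb₂ m (hnr₂ m)) (by simp; positivity)
  simp only [zero_mul, add_zero] at e₁ e₂
  refine conj_of_perturbation a₁ o₁ a₂ o₂ ?_ ?_
  · filter_upwards [e₁] with p h
    rw [h]; simp only [Pi.neg_apply]; ring
  · filter_upwards [e₂] with p h
    rw [h]; simp only [Pi.neg_apply]; ring

lemma conj_resonant {R₁ R₂ : ℂ × ℂ → ℂ} {lam₁ : ℂ} {k : ℕ} (hk : 2 ≤ k) (hlam₁ : lam₁ ≠ 0)
    (hR₁ : AnalyticAt ℂ R₁ 0) (hR₁' : R₁ =O[𝓝 0] fun p => ‖p‖ ^ 2)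
    (hR₂ : AnalyticAt ℂ R₂ 0) (hR₂' : R₂ =O[𝓝 0] fun p => ‖p‖ ^ 2) :
    ∃ c : ℂ, Conj (fun p => (lam₁ * p.1 + R₁ p, k * lam₁ * p.2 + R₂ p))
      (fun q => (lam₁ * q.1, k * lam₁ * q.2 + c * q.1 ^ k)) := by
  have hratio : ∀ r : ℝ, r ≤ 0 → (k : ℂ) * lam₁ ≠ (r : ℂ) * lam₁ := fun r hr h => by
    have h1 : ((k : ℝ) : ℂ) = r := by exact_mod_cast mul_right_cancel₀ hlam₁ h
    have h2 : (k : ℝ) = r := by exact_mod_cast h1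
    have h3 : (2 : ℝ) ≤ k := by exact_mod_cast hk
    linarith
  have hres : ∀ (m : Idx) (n : ℕ), m.1.1 * lam₁ + m.1.2 * (k * lam₁) = n * lam₁ →
      m.1.1 + m.1.2 * k = n := fun m n h => by
    have : ((m.1.1 + m.1.2 * k : ℕ) : ℂ) = (n : ℂ) := by
      push_cast; exact mul_right_cancel₀ hlam₁ (by linear_combination h)
    exact_mod_cast this
  have hnr₁ : ∀ m : Idx, m.1.1 * lam₁ + m.1.2 * (k * lam₁) ≠ lam₁ := fun m h => by
    have h1 := hres m 1 (by simpa using h)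
    have h2 := m.2
    have h3 : m.1.2 * 2 ≤ m.1.2 * k := Nat.mul_le_mul_left _ hk
    omega
  have hnr₂ : ∀ m : Idx, m ≠ ⟨(k, 0), hk⟩ → m.1.1 * lam₁ + m.1.2 * (k * lam₁) ≠ k * lam₁ :=
    fun m hm h => by
    have h1 := hres m k h
    have h2 := m.2
    rcases Nat.lt_or_ge m.1.2 1 with h3 | h3
    · have h4 : m.1.2 = 0 := by omega
      exact hm (Subtype.ext (Prod.ext (by simpa [h4] using h1) h4))
    · rcases Nat.lt_or_ge m.1.2 2 with h4 | h4
      · have h5 : m.1.2 = 1 := by omega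
        rw [h5] at h1 h2
        omega
      · have h5 : 2 * k ≤ m.1.2 * k := Nat.mul_le_mul_right _ h4
        omega
  obtain ⟨δ₁, hδ₁, hb₁⟩ := exists_divisor_bound hlam₁ hratio lam₁
  obtain ⟨δ₂, hδ₂, hb₂⟩ := exists_divisor_bound hlam₁ hratio (k * lam₁)
  obtain ⟨ψ₁, a₁, o₁, e₁⟩ := exists_nonresonant_solution (ε := 0) hR₁ hR₁' hR₂ hR₂' hR₁.neg
    hR₁'.neg_left hδ₁ (fun m => hb₁ m (hnr₁ m)) (by simp; positivity)
  obtain ⟨ψ₂, c, a₂, o₂, -, e₂⟩ := exists_homological_solution (ε := 0) (m₀ := ⟨(k, 0), hk⟩)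
    (g := fun p => (p.1 + ψ₁ p) ^ k) hR₁ hR₁' hR₂ hR₂' hR₂.neg hR₂'.neg_left
    ((analyticAt_fst.add a₁).pow k)
    (by simpa [mono] using pow_add_sub_pow_isBigO o₁ k)
    hδ₂ (fun m hm => hb₂ m (hnr₂ m hm)) (by simp; positivity)
  simp only [zero_mul, add_zero] at e₁ e₂
  refine ⟨c, conj_of_perturbation a₁ o₁ a₂ o₂ ?_ ?_⟩
  · filter_upwards [e₁] with p h
    rw [h]; simp only [Pi.neg_apply]; ring
  · filter_upwards [e₂] with p h
    rw [h]; simp only [Pi.neg_apply]; ring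

lemma conj_jordan {lam : ℂ} (hlam : lam ≠ 0) :
    ∃ ε : ℂ, ε ≠ 0 ∧ ∀ R₁ R₂ : ℂ × ℂ → ℂ,
      AnalyticAt ℂ R₁ 0 → (R₁ =O[𝓝 0] fun p => ‖p‖ ^ 2) →
      AnalyticAt ℂ R₂ 0 → (R₂ =O[𝓝 0] fun p => ‖p‖ ^ 2) →
      Conj (fun p => (lam * p.1 + ε * p.2 + R₁ p, lam * p.2 + R₂ p))
        (fun q => (lam * q.1 + ε * q.2, lam * q.2)) := by
  have hratio : ∀ r : ℝ, r ≤ 0 → lam ≠ (r : ℂ) * lam := fun r hr h => by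
    have h1 : (r : ℂ) = 1 := mul_right_cancel₀ hlam (by simpa using h.symm)
    have h2 : r = 1 := by exact_mod_cast h1
    linarith
  obtain ⟨δ, hδ, hb⟩ := exists_divisor_bound hlam hratio lam
  have hnr : ∀ m : Idx, m.1.1 * lam + m.1.2 * lam ≠ lam := fun m h => by
    have h1 : ((m.1.1 + m.1.2 : ℕ) : ℂ) = (1 : ℕ) := by
      push_cast; exact mul_right_cancel₀ hlam (by linear_combination h)
    have h2 : m.1.1 + m.1.2 = 1 := by exact_mod_cast h1
    have h3 := m.2
    omega
  have hε : ‖((δ / 8 : ℝ) : ℂ)‖ ≤ δ / 8 := by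
    rw [Complex.norm_real, Real.norm_of_nonneg (by positivity)]
  refine ⟨(δ / 8 : ℝ), by exact_mod_cast (by positivity : (δ / 8) ≠ 0),
    fun R₁ R₂ hR₁ hR₁' hR₂ hR₂' => ?_⟩
  generalize ((δ / 8 : ℝ) : ℂ) = ε at hε
  obtain ⟨ψ₂, a₂, o₂, e₂⟩ := exists_nonresonant_solution hR₁ hR₁' hR₂ hR₂' hR₂.neg
    hR₂'.neg_left hδ (fun m => hb m (hnr m)) hε
  obtain ⟨ψ₁, a₁, o₁, e₁⟩ := exists_nonresonant_solution hR₁ hR₁' hR₂ hR₂'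
    (hR₁.neg.add (analyticAt_const.mul a₂)) (hR₁'.neg_left.add (o₂.const_mul_left ε)) hδ
    (fun m => hb m (hnr m)) hε
  refine conj_of_perturbation a₁ o₁ a₂ o₂ ?_ ?_
  · filter_upwards [e₁] with p h
    rw [h]; simp only [Pi.neg_apply, Pi.add_apply, Pi.mul_apply]; ring
  · filter_upwards [e₂] with p h
    rw [h]; simp only [Pi.neg_apply]; ring

/-- A linear change of coordinates normalizes the linear part, leaving quadratic remainders. -/
lemma exists_remainders {X : ℂ × ℂ → ℂ × ℂ} (hX : AnalyticAt ℂ X 0) (hX0 : X 0 = 0)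
    (P : (ℂ × ℂ) ≃L[ℂ] (ℂ × ℂ)) {lam₁ lam₂ ε : ℂ}
    (hP : ∀ p, P (fderiv ℂ X 0 p) = (lam₁ * (P p).1 + ε * (P p).2, lam₂ * (P p).2)) :
    ∃ R₁ R₂ : ℂ × ℂ → ℂ, AnalyticAt ℂ R₁ 0 ∧ (R₁ =O[𝓝 0] fun p => ‖p‖ ^ 2) ∧
      AnalyticAt ℂ R₂ 0 ∧ (R₂ =O[𝓝 0] fun p => ‖p‖ ^ 2) ∧
      ∀ p, (lam₁ * (P p).1 + ε * (P p).2 + R₁ (P p), lam₂ * (P p).2 + R₂ (P p)) = P (X p) := by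
  have hs0 : P.symm 0 = 0 := map_zero _
  have hX' : AnalyticAt ℂ X (P.symm 0) := by rwa [hs0]
  have hXs : AnalyticAt ℂ (fun q => X (P.symm q)) 0 := hX'.fun_comp (P.symm.analyticAt 0)
  have hY : AnalyticAt ℂ (fun q => P (X (P.symm q))) 0 := (P.analyticAt _).fun_comp hXs
  have hd : HasFDerivAt (fun q => P (X (P.symm q))) ((P : ℂ × ℂ →L[ℂ] ℂ × ℂ).comp
      ((fderiv ℂ X 0).comp (P.symm : ℂ × ℂ →L[ℂ] ℂ × ℂ))) 0 := by
    have := hX'.differentiableAt.hasFDerivAt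
    have := P.hasFDerivAt.comp 0 (this.comp 0 P.symm.hasFDerivAt)
    rwa [hs0] at this
  have hv : ∀ v, P (fderiv ℂ X 0 (P.symm v)) = (lam₁ * v.1 + ε * v.2, lam₂ * v.2) := fun v => by
    rw [hP]; simp
  have hl₁ : HasFDerivAt (fun q : ℂ × ℂ => lam₁ * q.1 + ε * q.2)
      (lam₁ • ContinuousLinearMap.fst ℂ ℂ ℂ + ε • ContinuousLinearMap.snd ℂ ℂ ℂ) 0 :=
    (hasFDerivAt_fst.const_mul lam₁).add (hasFDerivAt_snd.const_mul ε)
  have hl₂ : HasFDerivAt (fun q : ℂ × ℂ => lam₂ * q.2)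
      (lam₂ • ContinuousLinearMap.snd ℂ ℂ ℂ) 0 := hasFDerivAt_snd.const_mul lam₂
  have a₁ : AnalyticAt ℂ (fun q => (P (X (P.symm q))).1 - (lam₁ * q.1 + ε * q.2)) 0 :=
    (analyticAt_fst.fun_comp hY).sub ((analyticAt_const.mul analyticAt_fst).add
      (analyticAt_const.mul analyticAt_snd))
  have a₂ : AnalyticAt ℂ (fun q => (P (X (P.symm q))).2 - lam₂ * q.2) 0 :=
    (analyticAt_snd.fun_comp hY).sub (analyticAt_const.mul analyticAt_snd)
  refine ⟨_, _, a₁, isBigO_sq_of_hasFDerivAt_zero a₁ (by simp [hX0]) ?_,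
    a₂, isBigO_sq_of_hasFDerivAt_zero a₂ (by simp [hX0]) ?_, fun p => by simp⟩
  · refine (hd.fst.sub hl₁).congr_fderiv ?_
    refine ContinuousLinearMap.ext fun v => ?_
    change (P (fderiv ℂ X 0 (P.symm v))).1 - (lam₁ * v.1 + ε * v.2) = 0
    rw [hv]; simp
  · refine (hd.snd.sub hl₂).congr_fderiv ?_
    refine ContinuousLinearMap.ext fun v => ?_
    change (P (fderiv ℂ X 0 (P.symm v))).2 - lam₂ * v.2 = 0
    rw [hv]; simp

/-- The resonant node with distinct eigenvalues `lam` and `k * lam`. -/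
lemma conj_linear_or_resonant {X : ℂ × ℂ → ℂ × ℂ} (hX : AnalyticAt ℂ X 0) (hX0 : X 0 = 0)
    {lam : ℂ} {k : ℕ} (hk : 2 ≤ k) (hlam : lam ≠ 0)
    (P : (ℂ × ℂ) ≃L[ℂ] (ℂ × ℂ))
    (hP : ∀ p, P (fderiv ℂ X 0 p) = (lam * (P p).1, k * lam * (P p).2)) :
    Conj X (fun q => (lam * q.1, k * lam * q.2)) ∨
      Conj X (fun q => (lam * (k * q.1 + q.2 ^ k), lam * q.2)) := by
  obtain ⟨R₁, R₂, a₁, o₁, a₂, o₂, hR⟩ := exists_remainders (ε := 0) hX hX0 P (by simpa using hP)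
  simp only [zero_mul, add_zero] at hR
  obtain ⟨c, hc⟩ := conj_resonant hk hlam a₁ o₁ a₂ o₂
  by_cases h0 : c = 0
  · left
    exact hc.congr_linear P (.refl ℂ _) hR (fun q => by simp [h0])
  · right
    refine hc.congr_linear P (planeEquiv 0 (lam / c) 1 0 (by simp [hlam, h0])) hR fun q => ?_
    ext
    · simp; field_simp
    · simp

lemma resonance_eq {lam₁ lam₂ : ℂ} (hlam₁ : lam₁ ≠ 0)
    (hratio : ∀ r : ℝ, r ≤ 0 → lam₂ ≠ (r : ℂ) * lam₁) {i j : ℕ} (hij : 2 ≤ i + j)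
    (h : i * lam₁ + j * lam₂ = lam₁) : 2 ≤ j ∧ lam₁ = j * lam₂ := by
  rcases Nat.eq_zero_or_pos i with rfl | hi
  · exact ⟨by omega, by simpa using h.symm⟩
  · exfalso
    rcases Nat.eq_zero_or_pos j with rfl | hj
    · have h1 : (i : ℂ) = 1 := mul_right_cancel₀ hlam₁ (by simpa using h)
      have h2 : i = 1 := by exact_mod_cast h1
      omega
    · have hi' : (1 : ℝ) ≤ i := by exact_mod_cast hi
      have hj' : (0 : ℝ) < j := by exact_mod_cast hj
      have hjC : (j : ℂ) ≠ 0 := by exact_mod_cast hj.ne'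
      refine hratio ((1 - i) / j) (div_nonpos_of_nonpos_of_nonneg (by linarith) hj'.le) ?_
      push_cast
      field_simp
      linear_combination h

end PoincareDulac

open PoincareDulac

/-- **Theorem (Poincaré–Dulac, eigenratio not a nonpositive real).**
Let `X` be a holomorphic germ at `0 ∈ ℂ²` with `X 0 = 0` whose linear part has
eigenvalues `lam₁ ≠ 0`, `lam₂` with `lam₂/lam₁ ∉ ℝ≤0` (encoded: the determinant
and trace of `DX(0)` are `lam₁·lam₂` and `lam₁ + lam₂`, and `lam₂ ≠ r·lam₁` for
every real `r ≤ 0`). Then, up to permuting `lam₁` and `lam₂`, `X` is analytically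
conjugate either to the linear field `μ₁·x∂x + μ₂·y∂y`, or—in the resonant node
case `μ₂ = k·μ₁`, `k ≥ 1` an integer—to `μ₁·(k·x + yᵏ)∂x + μ₁·y∂y`. -/
theorem poincare_dulac
    (X : ℂ × ℂ → ℂ × ℂ) (hX : AnalyticAt ℂ X 0) (hX0 : X 0 = 0)
    (lam₁ lam₂ : ℂ) (hlam₁ : lam₁ ≠ 0)
    (hratio : ∀ r : ℝ, r ≤ 0 → lam₂ ≠ (r : ℂ) * lam₁)
    (hdet : LinearMap.det ((fderiv ℂ X 0).toLinearMap) = lam₁ * lam₂)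
    (htr : LinearMap.trace ℂ (ℂ × ℂ) ((fderiv ℂ X 0).toLinearMap) = lam₁ + lam₂) :
    ∃ μ₁ μ₂ : ℂ, ((μ₁ = lam₁ ∧ μ₂ = lam₂) ∨ (μ₁ = lam₂ ∧ μ₂ = lam₁)) ∧
      ((∃ Φ : ℂ × ℂ → ℂ × ℂ, AnalyticAt ℂ Φ 0 ∧ Φ 0 = 0 ∧
          LinearMap.det ((fderiv ℂ Φ 0).toLinearMap) ≠ 0 ∧
          ∀ᶠ p in nhds (0 : ℂ × ℂ),
            fderiv ℂ Φ p (X p) = ((μ₁ * (Φ p).1, μ₂ * (Φ p).2) : ℂ × ℂ)) ∨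
       (∃ k : ℕ, 1 ≤ k ∧ μ₂ = (k : ℂ) * μ₁ ∧
          ∃ Φ : ℂ × ℂ → ℂ × ℂ, AnalyticAt ℂ Φ 0 ∧ Φ 0 = 0 ∧
          LinearMap.det ((fderiv ℂ Φ 0).toLinearMap) ≠ 0 ∧
          ∀ᶠ p in nhds (0 : ℂ × ℂ),
            fderiv ℂ Φ p (X p)
              = ((μ₁ * ((k : ℂ) * (Φ p).1 + (Φ p).2 ^ k), μ₁ * (Φ p).2) : ℂ × ℂ))) := by
  have hlam₂ : lam₂ ≠ 0 := by simpa using hratio 0 le_rfl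
  have hratio' : ∀ r : ℝ, r ≤ 0 → lam₁ ≠ (r : ℂ) * lam₂ := fun r hr h => by
    have hr0 : (r : ℂ) ≠ 0 := by rintro h0; simp [h0] at h; exact hlam₁ h
    refine hratio r⁻¹ (inv_nonpos.mpr hr) ?_
    push_cast
    rw [h, inv_mul_cancel_left₀ hr0]
  rcases exists_linear_normal_form (fderiv ℂ X 0) hdet htr with ⟨P, hP⟩ | ⟨rfl, hJ⟩
  · by_cases h₂ : ∃ k : ℕ, 2 ≤ k ∧ lam₂ = k * lam₁
    · obtain ⟨k, hk, rfl⟩ := h₂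
      refine ⟨lam₁, k * lam₁, Or.inl ⟨rfl, rfl⟩, ?_⟩
      rcases conj_linear_or_resonant hX hX0 hk hlam₁ P hP with h | h
      · exact Or.inl h
      · exact Or.inr ⟨k, by omega, rfl, h⟩
    by_cases h₁ : ∃ k : ℕ, 2 ≤ k ∧ lam₁ = k * lam₂
    · obtain ⟨k, hk, rfl⟩ := h₁
      refine ⟨lam₂, k * lam₂, Or.inr ⟨rfl, rfl⟩, ?_⟩
      have hP' : ∀ p, (P.trans (planeEquiv 0 1 1 0 (by simp))) (fderiv ℂ X 0 p)
          = (lam₂ * ((P.trans (planeEquiv 0 1 1 0 (by simp))) p).1,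
            k * lam₂ * ((P.trans (planeEquiv 0 1 1 0 (by simp))) p).2) := fun p => by
        simp [hP]
      rcases conj_linear_or_resonant hX hX0 hk hlam₂ _ hP' with h | h
      · exact Or.inl h
      · exact Or.inr ⟨k, by omega, rfl, h⟩
    refine ⟨lam₁, lam₂, Or.inl ⟨rfl, rfl⟩, Or.inl ?_⟩
    obtain ⟨R₁, R₂, a₁, o₁, a₂, o₂, hR⟩ :=
      exists_remainders (ε := 0) hX hX0 P (by simpa using hP)
    simp only [zero_mul, add_zero] at hR
    change Conj X (fun q => (lam₁ * q.1, lam₂ * q.2))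
    refine (conj_diagonal hlam₁ hratio a₁ o₁ a₂ o₂ (fun m h => ?_) (fun m h => ?_)).congr_linear
      P (.refl ℂ _) hR (fun q => rfl)
    · exact h₁ ⟨_, resonance_eq hlam₁ hratio m.2 h⟩
    · exact h₂ ⟨_, resonance_eq hlam₂ hratio' (by rw [add_comm]; exact m.2)
        (by rw [add_comm]; exact h)⟩
  · obtain ⟨ε, hε, hconj⟩ := conj_jordan hlam₁
    obtain ⟨P, hP⟩ := hJ ε hε
    obtain ⟨R₁, R₂, a₁, o₁, a₂, o₂, hR⟩ := exists_remainders hX hX0 P hP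
    refine ⟨lam₁, lam₁, Or.inl ⟨rfl, rfl⟩, Or.inr ⟨1, le_rfl, by simp, ?_⟩⟩
    change Conj X (fun q => (lam₁ * ((1 : ℕ) * q.1 + q.2 ^ 1), lam₁ * q.2))
    refine Conj.congr_linear P (planeEquiv (lam₁ / ε) 0 0 1 (by simp [hlam₁, hε])) hR
      (fun q => ?_) (hconj R₁ R₂ a₁ o₁ a₂ o₂)
    ext
    · simp; field_simp
    · simp
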